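/- arXiv:2103.01497 — 5 statements merged into one kernel-verified Lean document; each statement's English description precedes it below -/
import Mathlib

section
/- Let θ : ℤ²₀ → ℝ have finite support and be radially symmetric. Then for every x ∈ 𝕋², one has ∑_{k ∈ ℤ²₀} θ_k² σ_k(x) ⊗ σ_k(x) = (1/2) ‖θ‖²_{ℓ²} I₂, where ‖θ‖²_{ℓ²} = ∑_{k ∈ ℤ²₀} θ_k², σ_k(x) ⊗ σ_k(x) denotes the 2×2 matrix with entries σ_k(x)_i σ_k(x)_j, and I₂ is the 2×2 identity matrix. -/
open MeasureTheory Real Filter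
open scoped Classical

noncomputable section

abbrev T2 : Type := AddCircle (1:ℝ) × AddCircle (1:ℝ)

/-- cos(2π k·x) on the 2D torus. -/
def tCos (k : ℤ × ℤ) (x : T2) : ℝ := (fourier k.1 x.1 * fourier k.2 x.2).re

/-- sin(2π k·x) on the 2D torus. -/
def tSin (k : ℤ × ℤ) (x : T2) : ℝ := (fourier k.1 x.1 * fourier k.2 x.2).im

/-- The trigonometric basis functions e_k on the torus. -/
def eFun (k : ℤ × ℤ) (x : T2) : ℝ :=
  if k = 0 then 1
  else if 0 < k.1 ∨ (k.1 = 0 ∧ 0 < k.2) then Real.sqrt 2 * tCos k x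
  else Real.sqrt 2 * tSin k x

/-- |k| for k ∈ ℤ². -/
def knorm (k : ℤ × ℤ) : ℝ := Real.sqrt ((k.1:ℝ)^2 + (k.2:ℝ)^2)

/-- k⊥ = (k₂, -k₁). -/
def kperp (k : ℤ × ℤ) : Fin 2 → ℝ := ![(k.2:ℝ), -(k.1:ℝ)]

/-- The divergence-free vector fields σ_k(x) = (k⊥/|k|) e_k(x). -/
def sigmaV (k : ℤ × ℤ) (x : T2) : Fin 2 → ℝ := fun i => kperp k i / knorm k * eFun k x

/-- θ is radially symmetric: θ_k = θ_j whenever |k| = |j|. -/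
def Radial (θ : ℤ × ℤ → ℝ) : Prop := ∀ k j : ℤ × ℤ, knorm k = knorm j → θ k = θ j

/-- Rotation by a right angle on `ℤ²`. -/
def rotEquiv : ℤ × ℤ ≃ ℤ × ℤ where
  toFun k := (k.2, -k.1)
  invFun k := (-k.2, k.1)
  left_inv k := by simp
  right_inv k := by simp

lemma tCos_neg (k : ℤ × ℤ) (x : T2) : tCos (-k) x = tCos k x := by
  simp only [tCos, Prod.fst_neg, Prod.snd_neg, fourier_neg, ← map_mul, Complex.conj_re]

lemma tSin_neg (k : ℤ × ℤ) (x : T2) : tSin (-k) x = -tSin k x := by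
  simp only [tSin, Prod.fst_neg, Prod.snd_neg, fourier_neg, ← map_mul, Complex.conj_im]

lemma tCos_sq_add_tSin_sq (k : ℤ × ℤ) (x : T2) : tCos k x ^ 2 + tSin k x ^ 2 = 1 := by
  have h : ‖fourier k.1 x.1 * fourier k.2 x.2‖ = 1 := by
    rw [norm_mul, fourier_apply, fourier_apply, Circle.norm_coe, Circle.norm_coe, one_mul]
  rw [tCos, tSin, pow_two, pow_two, ← Complex.normSq_apply, Complex.normSq_eq_norm_sq, h, one_pow]

lemma eFun_sq_add_eFun_neg_sq {k : ℤ × ℤ} (hk : k ≠ 0) (x : T2) :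
    eFun k x ^ 2 + eFun (-k) x ^ 2 = 2 := by
  have h2 : Real.sqrt 2 ^ 2 = 2 := Real.sq_sqrt (by norm_num)
  have hsum := tCos_sq_add_tSin_sq k x
  obtain ⟨a, b⟩ := k
  have hab : a ≠ 0 ∨ b ≠ 0 := by
    by_contra! h
    exact hk (by simp [h.1, h.2])
  have hk' : -((a, b) : ℤ × ℤ) ≠ 0 := neg_ne_zero.mpr hk
  unfold eFun
  rw [if_neg hk, if_neg hk', tCos_neg, tSin_neg]
  simp only [Prod.fst_neg, Prod.snd_neg]
  by_cases hpos : 0 < a ∨ (a = 0 ∧ 0 < b)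
  · have hneg : ¬ (0 < -a ∨ (-a = 0 ∧ 0 < -b)) := by omega
    rw [if_pos hpos, if_neg hneg]
    linear_combination 2 * hsum + (tCos (a, b) x ^ 2 + tSin (a, b) x ^ 2) * h2
  · have hneg : 0 < -a ∨ (-a = 0 ∧ 0 < -b) := by omega
    rw [if_neg hpos, if_pos hneg]
    linear_combination 2 * hsum + (tCos (a, b) x ^ 2 + tSin (a, b) x ^ 2) * h2

lemma knorm_neg (k : ℤ × ℤ) : knorm (-k) = knorm k := by
  simp [knorm]

lemma knorm_rotEquiv (k : ℤ × ℤ) : knorm (rotEquiv k) = knorm k := by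
  simp [knorm, rotEquiv, add_comm]

lemma knorm_sq (k : ℤ × ℤ) : knorm k ^ 2 = (k.1 : ℝ) ^ 2 + (k.2 : ℝ) ^ 2 :=
  Real.sq_sqrt (by positivity)

lemma knorm_ne_zero {k : ℤ × ℤ} (hk : k ≠ 0) : knorm k ≠ 0 := by
  intro h
  have hsq := knorm_sq k
  rw [h] at hsq
  have h1 : (k.1 : ℝ) = 0 := by nlinarith [sq_nonneg (k.1 : ℝ), sq_nonneg (k.2 : ℝ)]
  have h2 : (k.2 : ℝ) = 0 := by nlinarith [sq_nonneg (k.1 : ℝ), sq_nonneg (k.2 : ℝ)]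
  exact hk (Prod.ext (by exact_mod_cast h1) (by exact_mod_cast h2))

lemma vecMulVec_sigmaV_add_neg {k : ℤ × ℤ} (hk : k ≠ 0) (x : T2) :
    Matrix.vecMulVec (sigmaV k x) (sigmaV k x)
        + Matrix.vecMulVec (sigmaV (-k) x) (sigmaV (-k) x)
      = (2 / knorm k ^ 2) • Matrix.vecMulVec (kperp k) (kperp k) := by
  have he := eFun_sq_add_eFun_neg_sq hk x
  have hperp (i : Fin 2) : kperp (-k) i = -kperp k i := by
    fin_cases i <;> simp [kperp]
  ext i j
  simp only [Matrix.add_apply, Matrix.smul_apply, Matrix.vecMulVec_apply, sigmaV, knorm_neg,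
    hperp, smul_eq_mul]
  rw [← he]
  ring

lemma vecMulVec_kperp_add_rotEquiv (k : ℤ × ℤ) :
    Matrix.vecMulVec (kperp k) (kperp k)
        + Matrix.vecMulVec (kperp (rotEquiv k)) (kperp (rotEquiv k))
      = knorm k ^ 2 • (1 : Matrix (Fin 2) (Fin 2) ℝ) := by
  rw [knorm_sq]
  ext i j
  fin_cases i <;> fin_cases j <;>
    simp [kperp, rotEquiv] <;> ring

/-- The sum over the orbit of `k` under rotations by right angles. -/
lemma vecMulVec_sigmaV_orbit_sum {k : ℤ × ℤ} (hk : k ≠ 0) (x : T2) :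
    (Matrix.vecMulVec (sigmaV k x) (sigmaV k x)
        + Matrix.vecMulVec (sigmaV (-k) x) (sigmaV (-k) x))
      + (Matrix.vecMulVec (sigmaV (rotEquiv k) x) (sigmaV (rotEquiv k) x)
        + Matrix.vecMulVec (sigmaV (-rotEquiv k) x) (sigmaV (-rotEquiv k) x))
      = (2 : ℝ) • (1 : Matrix (Fin 2) (Fin 2) ℝ) := by
  have hrot : rotEquiv k ≠ 0 := by
    intro h
    exact hk (rotEquiv.injective (h.trans (by simp [rotEquiv, Prod.zero_eq_mk])))
  rw [vecMulVec_sigmaV_add_neg hk, vecMulVec_sigmaV_add_neg hrot, knorm_rotEquiv, ← smul_add,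
    vecMulVec_kperp_add_rotEquiv, smul_smul, div_mul_cancel₀ _ (pow_ne_zero 2 (knorm_ne_zero hk))]

/-- For finitely supported, radially symmetric `θ : ℤ²₀ → ℝ` and every
`x ∈ 𝕋²`, one has `∑_{k ∈ ℤ²₀} θ_k² σ_k(x) ⊗ σ_k(x) = (1/2) ‖θ‖²_{ℓ²} I₂`. -/
theorem statement0 (θ : ℤ × ℤ → ℝ) (hfin : (Function.support θ).Finite)
    (hzero : θ 0 = 0) (hrad : Radial θ) (x : T2) :
    ∑ᶠ k : ℤ × ℤ, (θ k) ^ 2 • Matrix.vecMulVec (sigmaV k x) (sigmaV k x)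
      = ((1 / 2 : ℝ) * ∑ᶠ k : ℤ × ℤ, (θ k) ^ 2) • (1 : Matrix (Fin 2) (Fin 2) ℝ) := by
  set F : ℤ × ℤ → Matrix (Fin 2) (Fin 2) ℝ :=
    fun k => (θ k) ^ 2 • Matrix.vecMulVec (sigmaV k x) (sigmaV k x) with hF
  have hFfin : F.HasFiniteSupport := hfin.subset fun k hk hθ => hk (by simp [hF, hθ])
  have hdouble (G : ℤ × ℤ → Matrix (Fin 2) (Fin 2) ℝ) (hG : G.HasFiniteSupport)
      (e : ℤ × ℤ ≃ ℤ × ℤ) :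
      (fun k => G k + G (e k)).HasFiniteSupport ∧
        ∑ᶠ k, (G k + G (e k)) = (2 : ℝ) • ∑ᶠ k, G k := by
    have hGe : (fun k => G (e k)).HasFiniteSupport := hG.preimage e.injective.injOn
    refine ⟨(hG.union hGe).subset (Function.support_add G fun k => G (e k)), ?_⟩
    rw [finsum_add_distrib hG hGe, finsum_comp_equiv e, two_smul]
  obtain ⟨hGfin, hGsum⟩ := hdouble F hFfin (Equiv.neg _)
  obtain ⟨-, hsum⟩ := hdouble _ hGfin rotEquiv
  rw [hGsum] at hsum
  have horbit (k : ℤ × ℤ) :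
      (F k + F (Equiv.neg _ k)) + (F (rotEquiv k) + F (Equiv.neg _ (rotEquiv k)))
        = θ k ^ 2 • (2 : ℝ) • (1 : Matrix (Fin 2) (Fin 2) ℝ) := by
    have hrot : θ (rotEquiv k) = θ k := hrad _ _ (knorm_rotEquiv k)
    simp only [hF, Equiv.neg_apply, hrad _ _ (knorm_neg _), hrot, ← smul_add]
    by_cases hk : k = 0
    · simp [hk, hzero]
    · rw [vecMulVec_sigmaV_orbit_sum hk]
  simp only [horbit] at hsum
  rw [← finsum_smul] at hsum
  calc ∑ᶠ k, F k = (1 / 4 : ℝ) • (2 : ℝ) • (2 : ℝ) • ∑ᶠ k, F k := by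
        simp only [smul_smul]; norm_num
    _ = _ := by
        rw [← hsum]
        simp only [smul_smul]
        congr 1
        ring
end
end

section
/- Let N ≥ 2 and let F be a probability density on (𝕋²)^N (with respect to the product Haar probability measure) which is exchangeable, i.e. F(x_{π(1)}, …, x_{π(N)}) = F(x₁, …, x_N) almost everywhere for every permutation π of {1, …, N}, and such that F log F is integrable. Let F^{(2)}(x₁, x₂) = ∫_{(𝕋²)^{N−2}} F(x₁, x₂, x₃, …, x_N) dx₃ ⋯ dx_N be the two-variable marginal density, and assume F^{(2)} log F^{(2)} is integrable. Then h_N(F) ≥ ((N−1)/N) h₂(F^{(2)}), where h_m(G) := (1/m) ∫_{(𝕋²)^m} G log G. -/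
open MeasureTheory Real Filter
open scoped Classical

noncomputable section

namespace PairEntropy

section Marginals

variable {ι κ T : Type*} [Fintype ι] [Fintype κ] [MeasureSpace T]

/-- `F₂` is the density of the coordinates `i, j` under the density `F`. -/
def IsPairMarginal [DecidableEq ι] (i j : ι) (F : (ι → T) → ℝ) (F₂ : T × T → ℝ) : Prop :=
  ∀ a b : T, F₂ (a, b) = ∫ z : ι → T, F (Function.update (Function.update z i a) j b)

namespace IsPairMarginal

variable [DecidableEq ι] {i j : ι} {F : (ι → T) → ℝ} {F₂ : T × T → ℝ}

lemma eq_integral (h : IsPairMarginal i j F F₂) :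
    F₂ = fun p => ∫ z : ι → T, F (Function.update (Function.update z i p.1) j p.2) :=
  funext fun p => h p.1 p.2

lemma nonneg (h : IsPairMarginal i j F F₂) (hF : ∀ x, 0 ≤ F x) (p : T × T) : 0 ≤ F₂ p := by
  rw [h.eq_integral]; exact integral_nonneg fun _ => hF _

end IsPairMarginal

variable [IsProbabilityMeasure (volume : Measure T)]

lemma measurePreserving_update [DecidableEq ι] (i : ι) :
    MeasurePreserving (fun q : T × (ι → T) => Function.update q.2 i q.1) := by
  have hmeas : Measurable (fun q : T × (ι → T) => Function.update q.2 i q.1) := by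
    refine measurable_pi_lambda _ fun k => ?_
    by_cases h : k = i
    · subst h; simpa using measurable_fst
    · simpa [h] using (by fun_prop : Measurable fun q : T × (ι → T) => q.2 k)
  refine ⟨hmeas, (Measure.pi_eq fun s hs => ?_).symm⟩
  rw [Measure.map_apply hmeas (MeasurableSet.univ_pi hs)]
  have hpre : (fun q : T × (ι → T) => Function.update q.2 i q.1) ⁻¹' Set.univ.pi s
      = s i ×ˢ Set.univ.pi (Function.update s i Set.univ) := by
    ext ⟨a, z⟩
    simp only [Set.mem_preimage, Set.mem_univ_pi, Set.mem_prod]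
    constructor
    · intro h
      refine ⟨by simpa using h i, fun k => ?_⟩
      by_cases hk : k = i
      · subst hk; simp
      · simpa [hk] using h k
    · rintro ⟨ha, h⟩ k
      by_cases hk : k = i
      · subst hk; simpa using ha
      · simpa [hk] using h k
  rw [hpre, Measure.volume_eq_prod, Measure.prod_prod, volume_pi, Measure.pi_pi,
    ← Finset.mul_prod_erase _ _ (Finset.mem_univ i),
    ← Finset.mul_prod_erase _ (fun k => volume (s k)) (Finset.mem_univ i)]
  simp only [Function.update_self, measure_univ, one_mul]
  congr 1
  refine Finset.prod_congr rfl fun k hk => ?_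
  rw [Function.update_of_ne (Finset.ne_of_mem_erase hk)]

lemma measurePreserving_update_update [DecidableEq ι] (i j : ι) :
    MeasurePreserving (fun q : (T × T) × (ι → T) =>
      Function.update (Function.update q.2 i q.1.1) j q.1.2) := by
  have hswap : MeasurePreserving
      (Prod.map Prod.swap id : (T × T) × (ι → T) → (T × T) × (ι → T)) :=
    Measure.measurePreserving_swap.prod (MeasurePreserving.id _)
  have hassoc : MeasurePreserving
      (MeasurableEquiv.prodAssoc : (T × T) × (ι → T) ≃ᵐ T × (T × (ι → T))) :=
    measurePreserving_prodAssoc _ _ _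
  have hinner : MeasurePreserving (Prod.map id
      (fun q : T × (ι → T) => Function.update q.2 i q.1) :
        T × (T × (ι → T)) → T × (ι → T)) :=
    (MeasurePreserving.id _).prod (measurePreserving_update i)
  exact (measurePreserving_update j).comp (hinner.comp (hassoc.comp hswap))

lemma measurePreserving_comp_injective {σ : κ → ι} (hσ : Function.Injective σ) :
    MeasurePreserving (fun (x : ι → T) k => x (σ k)) := by
  refine ⟨by fun_prop, ?_⟩
  have hindep : ProbabilityTheory.iIndepFun (fun (i : ι) (x : ι → T) => x i)
      (volume : Measure (ι → T)) :=
    ProbabilityTheory.iIndepFun_pi (X := fun _ => id) fun _ => aemeasurable_id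
  have hmap := (hindep.precomp hσ).map_fun_eq_pi_map
    fun k => (measurable_pi_apply (σ k)).aemeasurable
  rw [hmap, volume_pi]
  congr 1
  ext1 k
  exact (measurePreserving_eval (fun _ : ι => (volume : Measure T)) (σ k)).map_eq

lemma measurePreserving_pairs {a b : κ → ι} (hab : Function.Injective (Sum.elim a b)) :
    MeasurePreserving (fun (x : ι → T) k => (x (a k), x (b k))) := by
  have hsum : MeasurePreserving (MeasurableEquiv.sumPiEquivProdPi fun _ : κ ⊕ κ => T) :=
    volume_measurePreserving_sumPiEquivProdPi _
  exact ((volume_measurePreserving_arrowProdEquivProdArrow T T κ).symm).comp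
    (hsum.comp (measurePreserving_comp_injective hab))

namespace IsPairMarginal

variable [DecidableEq ι] {i j : ι} {F : (ι → T) → ℝ} {F₂ : T × T → ℝ}

lemma measurable (h : IsPairMarginal i j F F₂) (hF : Measurable F) : Measurable F₂ := by
  rw [h.eq_integral]
  exact ((hF.comp (measurePreserving_update_update i j).measurable).stronglyMeasurable
    |>.integral_prod_right').measurable

lemma integrable (h : IsPairMarginal i j F F₂) (hF : Integrable F) : Integrable F₂ := by
  rw [h.eq_integral]
  exact ((measurePreserving_update_update i j).integrable_comp_of_integrable hF).integral_prod_left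

/-- Integrating a function of the coordinates `i, j` against `F` or against its marginal. -/
lemma integral_mul_comp (h : IsPairMarginal i j F F₂) (hij : i ≠ j) (hF : Measurable F)
    (hFpos : ∀ x, 0 ≤ F x) (hFint : Integrable F) {g : T × T → ℝ} (hg : Measurable g)
    (hint : Integrable fun p => F₂ p * g p) :
    Integrable (fun x : ι → T => F x * g (x i, x j)) ∧
      ∫ x : ι → T, F x * g (x i, x j) = ∫ p, F₂ p * g p := by
  have hφ := measurePreserving_update_update (T := T) i j
  set φ := fun q : (T × T) × (ι → T) => Function.update (Function.update q.2 i q.1.1) j q.1.2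
  have hi (q) : φ q i = q.1.1 := by simp [φ, hij]
  have hj (q) : φ q j = q.1.2 := by simp [φ]
  have hGmeas : Measurable (fun x : ι → T => F x * g (x i, x j)) := by fun_prop
  have hcomp : (fun x : ι → T => F x * g (x i, x j)) ∘ φ = fun q => F (φ q) * g q.1 := by
    ext q; simp [hi, hj]
  have hFφ : Integrable (fun q => F (φ q)) := hφ.integrable_comp_of_integrable hFint
  have hintφ : Integrable (fun q => F (φ q) * g q.1) := by
    refine (integrable_prod_iff ?_).2 ⟨?_, ?_⟩
    · rw [← hcomp]
      exact (hGmeas.comp hφ.measurable).aestronglyMeasurable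
    · filter_upwards [hFφ.prod_right_ae] with p hp using hp.mul_const _
    · refine hint.norm.congr (ae_of_all _ fun p => ?_)
      simp only [norm_mul, integral_mul_const]
      congr 1
      rw [Real.norm_of_nonneg (h.nonneg hFpos p), h.eq_integral]
      exact integral_congr_ae (ae_of_all _ fun z => (Real.norm_of_nonneg (hFpos _)).symm)
  refine ⟨(hφ.integrable_comp hGmeas.aestronglyMeasurable).1 (hcomp ▸ hintφ), ?_⟩
  calc ∫ x : ι → T, F x * g (x i, x j)
      = ∫ q, F (φ q) * g q.1 := by
        rw [← hφ.map_eq, integral_map hφ.measurable.aemeasurable hGmeas.aestronglyMeasurable]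
        exact congrArg (fun f => ∫ q, f q) hcomp
    _ = ∫ p, F₂ p * g p := by
        rw [Measure.volume_eq_prod, integral_prod _ hintφ]
        refine integral_congr_ae (ae_of_all _ fun p => ?_)
        simp only [integral_mul_const, h.eq_integral, φ]

/-- For exchangeable `F`, the marginal describes any pair of distinct coordinates. -/
lemma integral_mul_comp_of_exchangeable (h : IsPairMarginal i j F F₂) (hij : i ≠ j)
    (hF : Measurable F) (hFpos : ∀ x, 0 ≤ F x) (hFint : Integrable F)
    (hexch : ∀ e : Equiv.Perm ι, (fun x : ι → T => F (x ∘ e)) =ᵐ[volume] F)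
    {k l : ι} (hkl : k ≠ l) {g : T × T → ℝ} (hg : Measurable g)
    (hint : Integrable fun p => F₂ p * g p) :
    Integrable (fun x : ι → T => F x * g (x k, x l)) ∧
      ∫ x : ι → T, F x * g (x k, x l) = ∫ p, F₂ p * g p := by
  obtain ⟨e, rfl, rfl⟩ : ∃ e : Equiv.Perm ι, e i = k ∧ e j = l := by
    have hne : i ≠ Equiv.swap i k l := fun hc => hkl <| by
      simpa using (congrArg (Equiv.swap i k) hc)
    refine ⟨Equiv.swap i k * Equiv.swap j (Equiv.swap i k l), ?_, ?_⟩
    · simp [Equiv.swap_apply_of_ne_of_ne hij hne]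
    · simp
  obtain ⟨h1, h2⟩ := h.integral_mul_comp hij hF hFpos hFint hg hint
  have hGmeas : Measurable (fun x : ι → T => F x * g (x i, x j)) := by fun_prop
  have he : MeasurePreserving (fun (x : ι → T) k => x (e k)) :=
    measurePreserving_comp_injective e.injective
  have hae : (fun x : ι → T => F (x ∘ e) * g (x (e i), x (e j)))
      =ᵐ[volume] fun x => F x * g (x (e i), x (e j)) := by
    filter_upwards [hexch e] with x hx
    rw [hx]
  refine ⟨(he.integrable_comp_of_integrable h1).congr hae, ?_⟩
  rw [← integral_congr_ae hae, ← h2]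
  conv_rhs => rw [← he.map_eq, integral_map he.measurable.aemeasurable
    hGmeas.aestronglyMeasurable]
  rfl

lemma ae_eq_zero_of_exchangeable (h : IsPairMarginal i j F F₂) (hij : i ≠ j)
    (hF : Measurable F) (hFpos : ∀ x, 0 ≤ F x) (hFint : Integrable F)
    (hexch : ∀ e : Equiv.Perm ι, (fun x : ι → T => F (x ∘ e)) =ᵐ[volume] F)
    {k l : ι} (hkl : k ≠ l) : ∀ᵐ x : ι → T, F₂ (x k, x l) = 0 → F x = 0 := by
  have hF₂ := h.measurable hF
  let g : T × T → ℝ := (F₂ ⁻¹' {0}).indicator 1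
  have hg : Measurable g := measurable_one.indicator (hF₂ (measurableSet_singleton 0))
  have hzero : (fun p => F₂ p * g p) = fun _ => 0 := by
    ext p
    by_cases hp : F₂ p = 0 <;> simp [g, hp]
  obtain ⟨h1, h2⟩ := h.integral_mul_comp_of_exchangeable hij hF hFpos hFint hexch hkl hg
    (hzero ▸ integrable_zero _ _ _)
  rw [hzero, integral_zero, integral_eq_zero_iff_of_nonneg _ h1] at h2
  · filter_upwards [h2] with x hx hx0
    simpa [g, hx0] using hx
  · exact fun x => mul_nonneg (hFpos x) (Set.indicator_nonneg (fun _ _ => zero_le_one) _)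

end IsPairMarginal

end Marginals

lemma sub_le_mul_log_sub_mul_log {a b : ℝ} (ha : 0 ≤ a) (hb : 0 ≤ b) (h : b = 0 → a = 0) :
    a - b ≤ a * log a - a * log b := by
  rcases ha.eq_or_lt with rfl | ha
  · simpa using hb
  have hb : 0 < b := hb.lt_of_ne fun h0 => ha.ne' (h h0.symm)
  have hlog := Real.log_le_sub_one_of_pos (div_pos hb ha)
  rw [Real.log_div hb.ne' ha.ne'] at hlog
  have := mul_le_mul_of_nonneg_left hlog ha.le
  rw [mul_sub, mul_sub, mul_div_cancel₀ _ ha.ne'] at this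
  linarith

/-- The relative entropy of one probability density with respect to another is nonnegative. -/
lemma integral_mul_log_le {Ω : Type*} [MeasurableSpace Ω] {μ : Measure Ω} {f g : Ω → ℝ}
    (hf : ∀ x, 0 ≤ f x) (hg : ∀ x, 0 ≤ g x) (hfi : Integrable f μ) (hgi : Integrable g μ)
    (hmass : ∫ x, g x ∂μ = ∫ x, f x ∂μ) (hac : ∀ᵐ x ∂μ, g x = 0 → f x = 0)
    (hff : Integrable (fun x => f x * log (f x)) μ)
    (hfg : Integrable (fun x => f x * log (g x)) μ) :
    ∫ x, f x * log (g x) ∂μ ≤ ∫ x, f x * log (f x) ∂μ := by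
  have hle : ∫ x, (f x - g x) ∂μ ≤ ∫ x, (f x * log (f x) - f x * log (g x)) ∂μ := by
    refine integral_mono_ae (hfi.sub hgi) (hff.sub hfg) ?_
    filter_upwards [hac] with x hx using sub_le_mul_log_sub_mul_log (hf x) (hg x) hx
  rw [integral_sub hfi hgi, integral_sub hff hfg, hmass] at hle
  linarith

section Superadditivity

variable {ι κ T : Type*} [Fintype ι] [Fintype κ] [MeasureSpace T]
  [IsProbabilityMeasure (volume : Measure T)] [DecidableEq ι] {i j : ι} {F : (ι → T) → ℝ}
  {F₂ : T × T → ℝ}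

/-- The entropy of an exchangeable density dominates the sum of the entropies of the marginals
along any family of disjoint pairs of coordinates. -/
lemma card_mul_entropy_marginal_le (h : IsPairMarginal i j F F₂) (hij : i ≠ j)
    (hF : Measurable F) (hFpos : ∀ x, 0 ≤ F x) (hFone : ∫ x, F x = 1)
    (hexch : ∀ e : Equiv.Perm ι, (fun x : ι → T => F (x ∘ e)) =ᵐ[volume] F)
    (hFent : Integrable fun x => F x * log (F x)) (hF₂ent : Integrable fun p => F₂ p * log (F₂ p))
    {a b : κ → ι} (hab : Function.Injective (Sum.elim a b)) :
    (Fintype.card κ : ℝ) * ∫ p, F₂ p * log (F₂ p) ≤ ∫ x, F x * log (F x) := by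
  have hFint : Integrable F := integrable_of_integral_eq_one hFone
  have hF₂int := h.integrable hFint
  have hF₂one : ∫ p, F₂ p = 1 := by
    have := (h.integral_mul_comp hij hF hFpos hFint (g := fun _ => 1) measurable_const
      (by simpa using hF₂int)).2
    simpa [hFone] using this.symm
  have hne (k) : a k ≠ b k := fun hk => by simpa using hab (a₁ := .inl k) (a₂ := .inr k) hk
  have hpairs := measurePreserving_pairs (T := T) hab
  have hPint : Integrable fun y : κ → T × T => ∏ k, F₂ (y k) :=
    Integrable.fintype_prod (f := fun _ => F₂) fun _ => hF₂int
  have hPone : ∫ x : ι → T, ∏ k, F₂ (x (a k), x (b k)) = 1 := by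
    have hprod := integral_fintype_prod_volume_eq_pow (ι := κ) F₂
    rw [hF₂one, one_pow, ← hpairs.map_eq, integral_map hpairs.measurable.aemeasurable
      (hpairs.map_eq ▸ hPint.aestronglyMeasurable)] at hprod
    exact hprod
  have hzero : ∀ᵐ x : ι → T, ∀ k, F₂ (x (a k), x (b k)) = 0 → F x = 0 :=
    ae_all_iff.2 fun k => h.ae_eq_zero_of_exchangeable hij hF hFpos hFint hexch (hne k)
  have hlog : (fun x : ι → T => ∑ k, F x * log (F₂ (x (a k), x (b k))))
      =ᵐ[volume] fun x => F x * log (∏ k, F₂ (x (a k), x (b k))) := by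
    filter_upwards [hzero] with x hx
    by_cases hFx : F x = 0
    · simp [hFx]
    · rw [Real.log_prod fun k _ hk => hFx (hx k hk), Finset.mul_sum]
  have hpair (k) := h.integral_mul_comp_of_exchangeable hij hF hFpos hFint hexch (hne k)
    (h.measurable hF).log hF₂ent
  calc (Fintype.card κ : ℝ) * ∫ p, F₂ p * log (F₂ p)
      = ∫ x : ι → T, ∑ k, F x * log (F₂ (x (a k), x (b k))) := by
        rw [integral_finsetSum _ fun k _ => (hpair k).1,
          Finset.sum_congr rfl fun k _ => (hpair k).2]
        simp
    _ = ∫ x : ι → T, F x * log (∏ k, F₂ (x (a k), x (b k))) := integral_congr_ae hlog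
    _ ≤ ∫ x, F x * log (F x) := by
        refine integral_mul_log_le hFpos
          (fun x => Finset.prod_nonneg fun k _ => h.nonneg hFpos _) hFint
          (hpairs.integrable_comp_of_integrable hPint) (hPone.trans hFone.symm) ?_ hFent
          ((integrable_finsetSum _ fun k _ => (hpair k).1).congr hlog)
        filter_upwards [hzero] with x hx hprod
        obtain ⟨k, -, hk⟩ := Finset.prod_eq_zero_iff.1 hprod
        exact hx k hk

lemma entropy_marginal_nonneg (h : IsPairMarginal i j F F₂) (hij : i ≠ j)
    (hF : Measurable F) (hFpos : ∀ x, 0 ≤ F x) (hFone : ∫ x, F x = 1)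
    (hF₂ent : Integrable fun p => F₂ p * log (F₂ p)) :
    0 ≤ ∫ p, F₂ p * log (F₂ p) := by
  have hFint : Integrable F := integrable_of_integral_eq_one hFone
  have hF₂int := h.integrable hFint
  have hmarg := (h.integral_mul_comp hij hF hFpos hFint (g := fun _ => 1) measurable_const
    (by simpa using hF₂int)).2
  have := integral_mul_log_le (g := fun _ => 1) (h.nonneg hFpos) (fun _ => zero_le_one) hF₂int
    (integrable_const _) (by simpa [hFone] using hmarg) (by simp) hF₂ent (by simp)
  simpa using this

end Superadditivity

instance : IsProbabilityMeasure (volume : Measure (AddCircle (1 : ℝ))) :=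
  ⟨by simp [AddCircle.measure_univ]⟩

end PairEntropy

/-- For an exchangeable probability density `F` on `(𝕋²)^N` with integrable
entropy, the rescaled entropies satisfy `h_N(F) ≥ ((N−1)/N) h₂(F⁽²⁾)`, where `F⁽²⁾` is the
two-variable marginal of `F`. -/
theorem statement7 (N : ℕ) (hN : 2 ≤ N) (F : (Fin N → T2) → ℝ)
    (hFmeas : Measurable F) (hFpos : ∀ x, 0 ≤ F x)
    (hFone : ∫ x : Fin N → T2, F x = 1)
    (hexch : ∀ e : Equiv.Perm (Fin N),
      (fun x : Fin N → T2 => F (x ∘ e)) =ᵐ[(volume : Measure (Fin N → T2))] F)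
    (hFent : Integrable (fun x : Fin N → T2 => F x * Real.log (F x)))
    (F2 : T2 × T2 → ℝ)
    (hF2 : ∀ a b : T2, F2 (a, b) =
      ∫ z : Fin N → T2, F (Function.update (Function.update z ⟨0, by omega⟩ a) ⟨1, by omega⟩ b))
    (hF2ent : Integrable (fun p : T2 × T2 => F2 p * Real.log (F2 p))) :
    ((N : ℝ) - 1) / N * ((1 / 2 : ℝ) * ∫ p : T2 × T2, F2 p * Real.log (F2 p))
      ≤ (1 / N : ℝ) * ∫ x : Fin N → T2, F x * Real.log (F x) := by
  have hij : (⟨0, by omega⟩ : Fin N) ≠ ⟨1, by omega⟩ := by simp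
  have hpair : Function.Injective (Sum.elim
      (fun k : Fin (N / 2) => (⟨2 * k, by omega⟩ : Fin N))
      fun k : Fin (N / 2) => ⟨2 * k + 1, by omega⟩) := by
    rintro (k | k) (l | l) hkl <;> simp only [Sum.elim_inl, Sum.elim_inr, Fin.mk.injEq] at hkl
    · exact congrArg Sum.inl (Fin.ext (by lia : (k : ℕ) = l))
    · lia
    · lia
    · exact congrArg Sum.inr (Fin.ext (by lia : (k : ℕ) = l))
  have hmain := PairEntropy.card_mul_entropy_marginal_le hF2 hij hFmeas hFpos hFone hexch hFent
    hF2ent hpair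
  have hnonneg := PairEntropy.entropy_marginal_nonneg hF2 hij hFmeas hFpos hFone hF2ent
  rw [Fintype.card_fin] at hmain
  have hhalf : ((N : ℝ) - 1) / 2 ≤ (N / 2 : ℕ) := by
    have : (N : ℝ) ≤ 2 * (N / 2 : ℕ) + 1 := by exact_mod_cast (by omega : N ≤ 2 * (N / 2) + 1)
    linarith
  calc ((N : ℝ) - 1) / N * ((1 / 2 : ℝ) * ∫ p : T2 × T2, F2 p * Real.log (F2 p))
      = (1 / N : ℝ) * (((N : ℝ) - 1) / 2 * ∫ p : T2 × T2, F2 p * Real.log (F2 p)) := by ring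
    _ ≤ (1 / N : ℝ) * ∫ x : Fin N → T2, F x * Real.log (F x) := by
        gcongr
        exact (mul_le_mul_of_nonneg_right hhalf hnonneg).trans hmain
end
end

section
/- Let (Ω, μ) be a probability space, F : Ω → [0, ∞) a probability density with F log F μ-integrable, g : Ω → ℝ measurable with 0 ≤ g ≤ B for some constant B > 0, and M > 1. Then ∫_Ω g F dμ ≤ M ∫_Ω g dμ + (B / log M) (∫_Ω F log F dμ + e^{−1}). -/
open MeasureTheory Real

/-- The minimum of `t log t` on `[0, ∞)` is `-e⁻¹`. -/
theorem mul_log_add_exp_neg_one_nonneg {t : ℝ} (ht : 0 ≤ t) :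
    0 ≤ t * Real.log t + Real.exp (-1) := by
  rcases ht.eq_or_lt with rfl | ht
  · simpa using (Real.exp_pos (-1)).le
  · have h := mul_le_mul_of_nonneg_left (Real.add_one_le_exp (-1 - Real.log t)) ht.le
    rw [Real.exp_sub, Real.exp_log ht, mul_div_cancel₀ _ ht.ne'] at h
    linarith

/-- Pointwise truncation bound: split according to whether `t ≤ M` or `M < t`. -/
theorem mul_le_mul_add_div_log_mul {t a B M : ℝ} (ht : 0 ≤ t) (ha : 0 ≤ a) (haB : a ≤ B)
    (hM : 1 < M) :
    a * t ≤ M * a + B / Real.log M * (t * Real.log t + Real.exp (-1)) := by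
  have hlog : 0 < Real.log M := Real.log_pos hM
  have hB : 0 ≤ B := ha.trans haB
  have hc : 0 ≤ B / Real.log M := div_nonneg hB hlog.le
  rcases le_or_gt t M with htM | htM
  · have h₁ := mul_nonneg hc (mul_log_add_exp_neg_one_nonneg ht)
    have h₂ := mul_le_mul_of_nonneg_left htM ha
    linarith
  · have hle : Real.log M ≤ Real.log t := Real.log_le_log (by linarith) htM.le
    have hMa : 0 ≤ M * a := mul_nonneg (by linarith) ha
    have hexp := (Real.exp_pos (-1)).le
    calc a * t ≤ B * t := mul_le_mul_of_nonneg_right haB ht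
      _ = B / Real.log M * (t * Real.log M) := by field_simp
      _ ≤ B / Real.log M * (t * Real.log t + Real.exp (-1)) := by
        refine mul_le_mul_of_nonneg_left ?_ hc
        linarith [mul_le_mul_of_nonneg_left hle ht]
      _ ≤ _ := by linarith

/-- For a probability density `F` with integrable entropy, a measurable
`g` with `0 ≤ g ≤ B` and `M > 1`:
`∫ g F dμ ≤ M ∫ g dμ + (B/log M)(∫ F log F dμ + e⁻¹)`. -/
theorem statement9 {Ω : Type*} [MeasurableSpace Ω] (μ : Measure Ω) [IsProbabilityMeasure μ]
    (F : Ω → ℝ) (hFmeas : Measurable F) (hFpos : ∀ x, 0 ≤ F x)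
    (hFone : ∫ x, F x ∂μ = 1)
    (hFent : Integrable (fun x => F x * Real.log (F x)) μ)
    (g : Ω → ℝ) (hgmeas : Measurable g) (B : ℝ) (hB : 0 < B)
    (hg : ∀ x, 0 ≤ g x ∧ g x ≤ B) (M : ℝ) (hM : 1 < M) :
    ∫ x, g x * F x ∂μ
      ≤ M * (∫ x, g x ∂μ)
        + B / Real.log M * ((∫ x, F x * Real.log (F x) ∂μ) + Real.exp (-1)) := by
  have hgint : Integrable g μ :=
    Integrable.of_bound hgmeas.aestronglyMeasurable B
      (ae_of_all _ fun x => by rw [Real.norm_of_nonneg (hg x).1]; exact (hg x).2)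
  have hent : Integrable (fun x => F x * Real.log (F x) + Real.exp (-1)) μ :=
    hFent.add (integrable_const _)
  calc ∫ x, g x * F x ∂μ
      ≤ ∫ x, (M * g x + B / Real.log M * (F x * Real.log (F x) + Real.exp (-1))) ∂μ :=
        integral_mono_of_nonneg (ae_of_all _ fun x => mul_nonneg (hg x).1 (hFpos x))
          ((hgint.const_mul M).add (hent.const_mul _))
          (ae_of_all _ fun x => mul_le_mul_add_div_log_mul (hFpos x) (hg x).1 (hg x).2 hM)
    _ = _ := by
      rw [integral_add (hgint.const_mul M) (hent.const_mul _), integral_const_mul,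
        integral_const_mul, integral_add hFent (integrable_const _)]
      simp
end

section
/- Let N ≥ 1, let x₁, …, x_N be pairwise distinct points of 𝕋², and let S = (1/N) ∑_{i=1}^N δ_{x_i} be their empirical measure. Then for every r ∈ (0, 1/4) and every x ∈ 𝕋², one has S(B_r(x))² ≤ 1/N + (1 / (N² log(1/(2r)))) ∑_{1 ≤ i ≠ j ≤ N} max(log(1/d(x_i, x_j)), 0), where B_r(x) = {y ∈ 𝕋² : d(y, x) < r}. Consequently, sup_{x ∈ 𝕋²} S(B_r(x)) ≤ 1/√N + ((1 / (N² log(1/(2r)))) ∑_{1 ≤ i ≠ j ≤ N} max(log(1/d(x_i, x_j)), 0))^{1/2}. -/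
open MeasureTheory Real

noncomputable section

/-- The flat (Euclidean) quotient metric on the torus `𝕋² = ℝ²/ℤ²`. -/
def tdist (x y : T2) : ℝ := Real.sqrt (dist x.1 y.1 ^ 2 + dist x.2 y.2 ^ 2)

/-- Two points in a common ball of radius `r` are at distance less than `2 * r`. -/
lemma tdist_lt_two_mul {x y z : T2} {r : ℝ} (hr : 0 < r) (hx : tdist x z < r)
    (hy : tdist y z < r) : tdist x y < 2 * r := by
  unfold tdist at *
  rw [Real.sqrt_lt' hr] at hx hy
  rw [Real.sqrt_lt' (by positivity)]
  have h1 := dist_triangle_right x.1 y.1 z.1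
  have h2 := dist_triangle_right x.2 y.2 z.2
  have h3 := pow_le_pow_left₀ dist_nonneg h1 2
  have h4 := pow_le_pow_left₀ dist_nonneg h2 2
  nlinarith [sq_nonneg (dist x.1 z.1 - dist y.1 z.1), sq_nonneg (dist x.2 z.2 - dist y.2 z.2)]

lemma tdist_pos {x y : T2} (h : x ≠ y) : 0 < tdist x y := by
  unfold tdist
  apply Real.sqrt_pos.2
  by_cases h1 : x.1 = y.1
  · have h2 : 0 < dist x.2 y.2 := dist_pos.2 fun h2 => h (Prod.ext h1 h2)
    positivity
  · have h2 : 0 < dist x.1 y.1 := dist_pos.2 h1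
    positivity

/-- If a nonnegative kernel is at least `c` off the diagonal of `s × s`, then `c * #s ^ 2` is
bounded by `c * #ι` plus the off-diagonal sum of the kernel. -/
lemma mul_card_sq_le_add_sum_offDiag {ι : Type*} [Fintype ι] [DecidableEq ι] (s : Finset ι)
    (f : ι → ι → ℝ) {c : ℝ} (hc : 0 ≤ c) (hf : ∀ i j, 0 ≤ f i j)
    (hs : ∀ i ∈ s, ∀ j ∈ s, i ≠ j → c ≤ f i j) :
    c * (s.card : ℝ) ^ 2 ≤ c * Fintype.card ι + ∑ i, ∑ j, if i = j then 0 else f i j := by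
  have key : ∀ i j, (if i ∈ s then if j ∈ s then c else 0 else 0)
      ≤ (if i = j then c else 0) + if i = j then 0 else f i j := by
    intro i j
    have := hf i j
    have := hs i
    split_ifs <;> simp_all
  calc c * (s.card : ℝ) ^ 2
      = ∑ i, ∑ j, (if i ∈ s then if j ∈ s then c else 0 else 0) := by
        have h : ∀ i, ∑ j, (if i ∈ s then if j ∈ s then c else 0 else 0)
            = if i ∈ s then (s.card : ℝ) * c else 0 := by
          intro i
          split_ifs <;> simp
        simp only [h]
        simp
        ring
    _ ≤ ∑ i, ∑ j, ((if i = j then c else 0) + if i = j then 0 else f i j) :=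
        Finset.sum_le_sum fun i _ => Finset.sum_le_sum fun j _ => key i j
    _ = c * Fintype.card ι + ∑ i, ∑ j, if i = j then 0 else f i j := by
        simp [Finset.sum_add_distrib, mul_comm]

lemma sqrt_add_le_sqrt_add_sqrt (a b : ℝ) : √(a + b) ≤ √a + √b := by
  have le_sq (t : ℝ) : t ≤ √t ^ 2 := by
    rcases le_total 0 t with ht | ht
    · exact (Real.sq_sqrt ht).ge
    · exact ht.trans (sq_nonneg _)
  refine Real.sqrt_le_iff.2 ⟨by positivity, ?_⟩
  nlinarith [le_sq a, le_sq b, mul_nonneg (Real.sqrt_nonneg a) (Real.sqrt_nonneg b)]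

/-- For pairwise distinct points `x₁,…,x_N` of `𝕋²` with empirical measure
`S = (1/N)∑δ_{x_i}`, for every `r ∈ (0,1/4)` and every `x`:
`S(B_r(x))² ≤ 1/N + (1/(N² log(1/(2r)))) ∑_{i≠j} max(log(1/d(x_i,x_j)),0)`, and consequently
`S(B_r(x)) ≤ 1/√N + ((1/(N² log(1/(2r)))) ∑_{i≠j} max(log(1/d(x_i,x_j)),0))^{1/2}`. -/
theorem statement11 (N : ℕ) (hN : 1 ≤ N) (xs : Fin N → T2) (hinj : Function.Injective xs)
    (r : ℝ) (hr0 : 0 < r) (hr : r < 1 / 4) (x : T2) :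
    ((({i : Fin N | tdist (xs i) x < r}.ncard : ℝ) / N) ^ 2
      ≤ 1 / N + 1 / ((N : ℝ) ^ 2 * Real.log (1 / (2 * r)))
          * ∑ i : Fin N, ∑ j : Fin N,
              if i = j then 0 else max (Real.log (1 / tdist (xs i) (xs j))) 0) ∧
    (({i : Fin N | tdist (xs i) x < r}.ncard : ℝ) / N
      ≤ 1 / Real.sqrt N
        + Real.sqrt (1 / ((N : ℝ) ^ 2 * Real.log (1 / (2 * r)))
            * ∑ i : Fin N, ∑ j : Fin N,
                if i = j then 0 else max (Real.log (1 / tdist (xs i) (xs j))) 0)) := by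
  have hL : 0 < Real.log (1 / (2 * r)) :=
    Real.log_pos (by rw [lt_div_iff₀ (by positivity)]; linarith)
  have hNpos : (0 : ℝ) < N := by exact_mod_cast hN
  have hsq : (({i : Fin N | tdist (xs i) x < r}.ncard : ℝ) / N) ^ 2
      ≤ 1 / N + 1 / ((N : ℝ) ^ 2 * Real.log (1 / (2 * r)))
          * ∑ i : Fin N, ∑ j : Fin N,
              if i = j then 0 else max (Real.log (1 / tdist (xs i) (xs j))) 0 := by
    have h := mul_card_sq_le_add_sum_offDiag {i : Fin N | tdist (xs i) x < r}.toFinite.toFinset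
      (fun i j => max (Real.log (1 / tdist (xs i) (xs j))) 0) hL.le
      (fun _ _ => le_max_right _ _) (by
        intro i hi j hj hij
        rw [Set.Finite.mem_toFinset, Set.mem_ofPred_eq] at hi hj
        have hpos := tdist_pos (hinj.ne hij)
        exact le_max_of_le_left (Real.log_le_log (by positivity)
          (one_div_le_one_div_of_le hpos (tdist_lt_two_mul hr0 hi hj).le)))
    rw [← Set.ncard_eq_toFinset_card, Fintype.card_fin] at h
    generalize Real.log (1 / (2 * r)) = L at *
    generalize (∑ i : Fin N, ∑ j : Fin N,
      if i = j then 0 else max (Real.log (1 / tdist (xs i) (xs j))) 0) = E at *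
    have hE : 1 / (N : ℝ) + 1 / ((N : ℝ) ^ 2 * L) * E = (L * N + E) / ((N : ℝ) ^ 2 * L) := by
      field_simp
    rw [hE, le_div_iff₀ (by positivity), div_pow]
    calc _ = L * ({i : Fin N | tdist (xs i) x < r}.ncard : ℝ) ^ 2 := by field_simp
      _ ≤ _ := h
  refine ⟨hsq, ?_⟩
  calc _ ≤ Real.sqrt _ := Real.le_sqrt_of_sq_le hsq
    _ ≤ _ := sqrt_add_le_sqrt_add_sqrt _ _
    _ = _ := by rw [Real.sqrt_div zero_le_one, Real.sqrt_one]
end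
end

section
/- Let ν > 0, and for each N ∈ ℕ define θ^N : ℤ²₀ → ℝ by θ^N_k = (1/|k|) 1_{{|k| ≤ N}}, ε_N = 2√ν / ‖θ^N‖_{ℓ²}, and Q_N(x) = ∑_{k ∈ ℤ²₀, |k| ≤ N} (k⊥ ⊗ k⊥ / |k|⁴) cos(2π k·x) for x ∈ 𝕋². Then for every x ∈ 𝕋² with x ≠ 0, the matrices ε_N² Q_N(x) converge to the zero matrix as N → ∞. -/
open MeasureTheory Real Filter
open scoped Classical

noncomputable section

/-- The coefficients `θ^N_k = (1/|k|) 1_{{|k| ≤ N}}`. -/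
def thetaN (N : ℕ) (k : ℤ × ℤ) : ℝ :=
  if k ≠ 0 ∧ knorm k ≤ (N : ℝ) then 1 / knorm k else 0

/-- `Q_N(x) = ∑_{k ∈ ℤ²₀, |k| ≤ N} (k⊥ ⊗ k⊥/|k|⁴) cos(2π k·x)`. -/
def QN (N : ℕ) (x : T2) : Matrix (Fin 2) (Fin 2) ℝ :=
  ∑ᶠ k : ℤ × ℤ,
    if k ≠ 0 ∧ knorm k ≤ (N : ℝ) then
      (tCos k x / knorm k ^ 4) • Matrix.vecMulVec (kperp k) (kperp k)
    else 0

/-- The Gaussian integer attached to a lattice point, as a complex number. -/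
def latticeToComplex (k : ℤ × ℤ) : ℂ := ⟨k.1, k.2⟩

/-- The lattice points of norm at most `N`. -/
def latticeBall (N : ℕ) : Finset (ℤ × ℤ) :=
  (Finset.Icc (-(N : ℤ)) N ×ˢ Finset.Icc (-(N : ℤ)) N).filter
    fun k => k.1 ^ 2 + k.2 ^ 2 ≤ (N : ℤ) ^ 2

lemma mem_latticeBall {N : ℕ} {k : ℤ × ℤ} :
    k ∈ latticeBall N ↔ k.1 ^ 2 + k.2 ^ 2 ≤ (N : ℤ) ^ 2 := by
  simp only [latticeBall, Finset.mem_filter, Finset.mem_product, Finset.mem_Icc,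
    and_iff_right_iff_imp]
  intro h
  have hN : (0 : ℤ) ≤ N := by positivity
  exact ⟨abs_le.1 (abs_le_of_sq_le_sq (by nlinarith [sq_nonneg k.2]) hN),
    abs_le.1 (abs_le_of_sq_le_sq (by nlinarith [sq_nonneg k.1]) hN)⟩

lemma knorm_nonneg (k : ℤ × ℤ) : 0 ≤ knorm k := Real.sqrt_nonneg _

lemma knorm_le_iff {N : ℕ} {k : ℤ × ℤ} : knorm k ≤ N ↔ k ∈ latticeBall N := by
  rw [mem_latticeBall, ← sq_le_sq₀ (knorm_nonneg k) (Nat.cast_nonneg N), knorm_sq]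
  exact_mod_cast Iff.rfl

lemma norm_latticeToComplex (k : ℤ × ℤ) : ‖latticeToComplex k‖ = knorm k := by
  simp [latticeToComplex, knorm, Complex.norm_def, Complex.normSq_apply, sq]

lemma latticeToComplex_add (k l : ℤ × ℤ) :
    latticeToComplex (k + l) = latticeToComplex k + latticeToComplex l := by
  simp [latticeToComplex, Complex.ext_iff]

lemma latticeToComplex_eq_zero {k : ℤ × ℤ} : latticeToComplex k = 0 ↔ k = 0 := by
  simp [latticeToComplex, Complex.ext_iff, Prod.ext_iff]

lemma one_le_knorm {k : ℤ × ℤ} (hk : k ≠ 0) : 1 ≤ knorm k := by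
  have h : (1 : ℤ) ≤ k.1 ^ 2 + k.2 ^ 2 := by
    by_contra! h
    have h1 : k.1 = 0 := by nlinarith [sq_nonneg k.1, sq_nonneg k.2]
    have h2 : k.2 = 0 := by nlinarith [sq_nonneg k.1, sq_nonneg k.2]
    exact hk (Prod.ext h1 h2)
  exact Real.one_le_sqrt.2 (by exact_mod_cast h)

lemma summable_knorm_inv_pow_three : Summable fun k : ℤ × ℤ => (knorm k)⁻¹ ^ 3 := by
  have h := (finTwoArrowEquiv ℤ).symm.summable_iff.2
    (EisensteinSeries.summable_one_div_norm_rpow (k := 3) (by norm_num))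
  refine h.of_nonneg_of_le (fun k => by have := knorm_nonneg k; positivity) fun k => ?_
  simp only [Function.comp_apply]
  rcases eq_or_ne k 0 with rfl | hk
  · simp only [knorm, Prod.fst_zero, Prod.snd_zero]
    norm_num
  have hk' : (finTwoArrowEquiv ℤ).symm k ≠ 0 := by
    intro h0
    exact hk ((finTwoArrowEquiv ℤ).symm_apply_eq.1 h0)
  have hle : ‖(finTwoArrowEquiv ℤ).symm k‖ ≤ knorm k := by
    refine (pi_norm_le_iff_of_nonneg (knorm_nonneg k)).2 fun i => ?_
    fin_cases i
    · have h : (k.1 : ℝ) ^ 2 ≤ (k.1 : ℝ) ^ 2 + (k.2 : ℝ) ^ 2 := by nlinarith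
      exact Real.abs_le_sqrt h
    · have h : (k.2 : ℝ) ^ 2 ≤ (k.1 : ℝ) ^ 2 + (k.2 : ℝ) ^ 2 := by nlinarith
      exact Real.abs_le_sqrt h
  rw [Real.rpow_neg (norm_nonneg _), inv_pow]
  have hpos : 0 < ‖(finTwoArrowEquiv ℤ).symm k‖ := norm_pos_iff.2 hk'
  rw [show (3 : ℝ) = ((3 : ℕ) : ℝ) by norm_num, Real.rpow_natCast]
  gcongr

lemma not_summable_knorm_inv_sq : ¬ Summable fun k : ℤ × ℤ => (knorm k)⁻¹ ^ 2 := by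
  intro h
  let e : (Σ m : ℕ, Fin (m + 1)) → ℤ × ℤ := fun p => ((p.1 : ℤ) + 1, (p.2 : ℤ))
  have he : Function.Injective e := by
    rintro ⟨m, i⟩ ⟨n, j⟩ hmn
    simp only [e, Prod.mk.injEq, add_left_inj, Nat.cast_inj] at hmn
    obtain ⟨rfl, hij⟩ := hmn
    rw [Fin.ext hij]
  have hs := ((summable_sigma_of_nonneg (fun p => sq_nonneg _)).1 (h.comp_injective he)).2
  refine not_summable_natCast_inv ((summable_nat_add_iff 1).1 ?_)
  refine (hs.mul_left 2).of_nonneg_of_le (fun m => by positivity) fun m => ?_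
  simp only [tsum_fintype]
  have hterm : ∀ i : Fin (m + 1), (2 * ((m : ℝ) + 1) ^ 2)⁻¹ ≤ (knorm (e ⟨m, i⟩))⁻¹ ^ 2 := by
    intro i
    rw [inv_pow, knorm_sq]
    have hi : ((i : ℕ) : ℝ) ≤ m := by exact_mod_cast Nat.lt_succ_iff.1 i.2
    have hi0 : (0 : ℝ) ≤ ((i : ℕ) : ℝ) := by positivity
    simp only [e]
    push_cast
    gcongr
    nlinarith
  have hsum := Finset.sum_le_sum fun i (_ : i ∈ Finset.univ) => hterm i
  rw [Finset.sum_const, Finset.card_univ, Fintype.card_fin, nsmul_eq_mul] at hsum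
  refine le_trans (le_of_eq ?_) (mul_le_mul_of_nonneg_left hsum zero_le_two)
  push_cast
  field_simp

lemma tendsto_sum_latticeBall_knorm_inv_sq :
    Tendsto (fun N => ∑ k ∈ latticeBall N, (knorm k)⁻¹ ^ 2) atTop atTop := by
  have hmono : Monotone latticeBall := by
    intro M N h k hk
    rw [← knorm_le_iff] at hk ⊢
    exact hk.trans (by exact_mod_cast h)
  have hexh : ∀ k, ∃ N, k ∈ latticeBall N := fun k =>
    (exists_nat_ge (knorm k)).imp fun _ h => knorm_le_iff.1 h
  have hsmono : Monotone fun s : Finset (ℤ × ℤ) => ∑ k ∈ s, (knorm k)⁻¹ ^ 2 :=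
    Finset.sum_mono_set_of_nonneg fun k => by positivity
  refine (tendsto_atTop_atTop_of_monotone hsmono fun b => ?_).comp
    (tendsto_atTop_finset_of_monotone hmono hexh)
  by_contra! hb
  exact not_summable_knorm_inv_sq
    (summable_of_sum_le (fun k => by positivity) fun s => (hb s).le)

lemma inv_sq_le_of_not_mem_latticeBall {N : ℕ} (hN : 2 ≤ N) {k : ℤ × ℤ}
    (h : k ∉ latticeBall N ∨ k - (1, 0) ∉ latticeBall N) : (knorm k)⁻¹ ^ 2 ≤ 4 / (N : ℝ) ^ 2 := by
  have hN' : (2 : ℤ) ≤ N := by exact_mod_cast hN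
  have hq : (N : ℤ) ^ 2 ≤ 4 * (k.1 ^ 2 + k.2 ^ 2) := by
    simp only [mem_latticeBall, not_le, Prod.fst_sub, Prod.snd_sub, sub_zero] at h
    rcases h with h | h
    · nlinarith
    · nlinarith [sq_nonneg (k.1 + 1), sq_nonneg k.2]
  have hq' : (N : ℝ) ^ 2 ≤ 4 * knorm k ^ 2 := by
    rw [knorm_sq]
    exact_mod_cast hq
  have hNpos : (0 : ℝ) < (N : ℝ) ^ 2 := by positivity
  have hkpos : 0 < knorm k ^ 2 := by linarith
  rw [inv_pow, inv_eq_one_div, div_le_div_iff₀ hkpos hNpos]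
  linarith

lemma card_le_of_injOn_snd {N : ℕ} {s : Finset (ℤ × ℤ)} (hs : ∀ k ∈ s, k.2 ^ 2 ≤ (N : ℤ) ^ 2)
    (hinj : Set.InjOn Prod.snd (s : Set (ℤ × ℤ))) : s.card ≤ 2 * N + 1 := by
  have h := Finset.card_le_card_of_injOn (t := Finset.Icc (-(N : ℤ)) N) Prod.snd
    (fun k hk => Finset.mem_coe.2 (Finset.mem_Icc.2
      (abs_le.1 (abs_le_of_sq_le_sq (hs k hk) (by positivity))))) hinj
  rw [Int.card_Icc] at h
  omega

lemma card_shift_sdiff_latticeBall_le (N : ℕ) :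
    ((latticeBall N).map (addRightEmbedding (1, 0)) \ latticeBall N).card ≤ 2 * N + 1 := by
  have key : ∀ k ∈ (latticeBall N).map (addRightEmbedding (1, 0)) \ latticeBall N,
      (k.1 - 1) ^ 2 + k.2 ^ 2 ≤ (N : ℤ) ^ 2 ∧ (N : ℤ) ^ 2 < k.1 ^ 2 + k.2 ^ 2 := by
    intro k hk
    simp only [Finset.mem_sdiff, Finset.mem_map, addRightEmbedding_apply] at hk
    obtain ⟨⟨l, hl, rfl⟩, hk⟩ := hk
    rw [mem_latticeBall] at hl hk
    simp only [Prod.fst_add, Prod.snd_add, add_sub_cancel_right, add_zero, not_le] at hk ⊢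
    exact ⟨hl, hk⟩
  refine card_le_of_injOn_snd (fun k hk => by nlinarith [key k hk, sq_nonneg (k.1 - 1)]) ?_
  intro k hk l hl hkl
  obtain ⟨h1, h2⟩ := key k hk
  obtain ⟨h3, h4⟩ := key l hl
  have hkl' : k.2 = l.2 := hkl
  rw [hkl'] at h1 h2
  refine Prod.ext ?_ hkl'
  rcases lt_trichotomy k.1 l.1 with h | h | h
  · nlinarith
  · exact h
  · nlinarith

lemma card_latticeBall_sdiff_shift_le (N : ℕ) :
    (latticeBall N \ (latticeBall N).map (addRightEmbedding (1, 0))).card ≤ 2 * N + 1 := by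
  have key : ∀ k ∈ latticeBall N \ (latticeBall N).map (addRightEmbedding (1, 0)),
      k.1 ^ 2 + k.2 ^ 2 ≤ (N : ℤ) ^ 2 ∧ (N : ℤ) ^ 2 < (k.1 - 1) ^ 2 + k.2 ^ 2 := by
    intro k hk
    simp only [Finset.mem_sdiff, Finset.mem_map, addRightEmbedding_apply, not_exists, not_and] at hk
    refine ⟨mem_latticeBall.1 hk.1, ?_⟩
    by_contra! h
    exact hk.2 (k - (1, 0)) (mem_latticeBall.2 (by simpa using h)) (by simp)
  refine card_le_of_injOn_snd (fun k hk => by nlinarith [key k hk, sq_nonneg k.1]) ?_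
  intro k hk l hl hkl
  obtain ⟨h1, h2⟩ := key k hk
  obtain ⟨h3, h4⟩ := key l hl
  have hkl' : k.2 = l.2 := hkl
  rw [hkl'] at h1 h2
  refine Prod.ext ?_ hkl'
  rcases lt_trichotomy k.1 l.1 with h | h | h
  · nlinarith
  · exact h
  · nlinarith

/-- Moving the lattice ball by one unit changes a sum of terms of size `|k|⁻²` by a bounded
amount. -/
lemma norm_sum_shift_sub_sum_le {F : ℤ × ℤ → ℂ} (hF : ∀ k, ‖F k‖ ≤ (knorm k)⁻¹ ^ 2) {N : ℕ}
    (hN : 2 ≤ N) :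
    ‖∑ k ∈ latticeBall N, F (k + (1, 0)) - ∑ k ∈ latticeBall N, F k‖ ≤ 24 := by
  have hmap : ∑ k ∈ latticeBall N, F (k + (1, 0)) =
      ∑ k ∈ (latticeBall N).map (addRightEmbedding (1, 0)), F k := by
    simp [Finset.sum_map]
  rw [hmap, ← Finset.sum_sdiff_sub_sum_sdiff]
  have hN' : (2 : ℝ) ≤ N := by exact_mod_cast hN
  have hcount : ∀ s : Finset (ℤ × ℤ), s.card ≤ 2 * N + 1 →
      (∀ k ∈ s, k ∉ latticeBall N ∨ k - (1, 0) ∉ latticeBall N) → ‖∑ k ∈ s, F k‖ ≤ 12 := by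
    intro s hs hmem
    have hs' : (s.card : ℝ) ≤ 2 * N + 1 := by exact_mod_cast hs
    calc ‖∑ k ∈ s, F k‖ ≤ ∑ _k ∈ s, 4 / (N : ℝ) ^ 2 := norm_sum_le_of_le _ fun k hk =>
          (hF k).trans (inv_sq_le_of_not_mem_latticeBall hN (hmem k hk))
      _ = s.card * (4 / (N : ℝ) ^ 2) := by rw [Finset.sum_const, nsmul_eq_mul]
      _ ≤ (2 * N + 1) * (4 / (N : ℝ) ^ 2) := by gcongr
      _ ≤ 12 := by
        rw [mul_div_assoc', div_le_iff₀ (by positivity)]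
        nlinarith
  refine (norm_sub_le _ _).trans ?_
  have h1 := hcount _ (card_shift_sdiff_latticeBall_le N) fun k hk =>
    Or.inl (Finset.mem_sdiff.1 hk).2
  have h2 := hcount _ (card_latticeBall_sdiff_shift_le N) fun k hk => Or.inr fun hk' =>
    (Finset.mem_sdiff.1 hk).2 (Finset.mem_map.2 ⟨_, hk', by simp⟩)
  linarith

/-- Summation by parts in the first coordinate: exponential sums with slowly varying coefficients
are bounded away from the frequency zero. -/
lemma exists_norm_sum_latticeBall_le_of_fst {a χ : ℤ × ℤ → ℂ} {z : ℂ}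
    (ha : ∀ k, ‖a k‖ ≤ (knorm k)⁻¹ ^ 2) (hd : Summable fun k => ‖a (k + (1, 0)) - a k‖)
    (hχ : ∀ k, ‖χ k‖ = 1) (hz : z ≠ 1) (hshift : ∀ k, χ (k + (1, 0)) = z * χ k) :
    ∃ C, ∀ N, 2 ≤ N → ‖∑ k ∈ latticeBall N, a k * χ k‖ ≤ C := by
  refine ⟨(24 + ‖z‖ * ∑' k, ‖a (k + (1, 0)) - a k‖) / ‖z - 1‖, fun N hN => ?_⟩
  have hpos : 0 < ‖z - 1‖ := norm_pos_iff.2 (sub_ne_zero.2 hz)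
  rw [le_div_iff₀ hpos, mul_comm, ← norm_mul]
  have hE := norm_sum_shift_sub_sum_le (F := fun k => a k * χ k)
    (fun k => by rw [norm_mul, hχ, mul_one]; exact ha k) hN
  have hD : ‖∑ k ∈ latticeBall N, (a (k + (1, 0)) - a k) * χ k‖ ≤
      ∑' k, ‖a (k + (1, 0)) - a k‖ :=
    (norm_sum_le_of_le _ fun k _ => by rw [norm_mul, hχ, mul_one]).trans
      (hd.sum_le_tsum _ fun k _ => norm_nonneg _)
  have hid : (z - 1) * ∑ k ∈ latticeBall N, a k * χ k =
      (∑ k ∈ latticeBall N, a (k + (1, 0)) * χ (k + (1, 0)) - ∑ k ∈ latticeBall N, a k * χ k) -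
        z * ∑ k ∈ latticeBall N, (a (k + (1, 0)) - a k) * χ k := by
    simp only [hshift, Finset.mul_sum, ← Finset.sum_sub_distrib]
    exact Finset.sum_congr rfl fun k _ => by ring
  rw [hid]
  refine (norm_sub_le _ _).trans (add_le_add hE ?_)
  rw [norm_mul]
  gcongr

lemma knorm_swap (k : ℤ × ℤ) : knorm k.swap = knorm k := by
  simp [knorm, add_comm]

/-- Summation by parts in the second coordinate. -/
lemma exists_norm_sum_latticeBall_le_of_snd {a χ : ℤ × ℤ → ℂ} {z : ℂ}
    (ha : ∀ k, ‖a k‖ ≤ (knorm k)⁻¹ ^ 2) (hd : Summable fun k => ‖a (k + (0, 1)) - a k‖)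
    (hχ : ∀ k, ‖χ k‖ = 1) (hz : z ≠ 1) (hshift : ∀ k, χ (k + (0, 1)) = z * χ k) :
    ∃ C, ∀ N, 2 ≤ N → ‖∑ k ∈ latticeBall N, a k * χ k‖ ≤ C := by
  obtain ⟨C, hC⟩ := exists_norm_sum_latticeBall_le_of_fst (a := a ∘ Prod.swap)
    (χ := χ ∘ Prod.swap) (fun k => (ha k.swap).trans_eq (by rw [knorm_swap]))
    ((Equiv.prodComm ℤ ℤ).summable_iff.2 hd) (fun k => hχ _) hz (fun k => hshift k.swap)
  refine ⟨C, fun N hN => le_of_eq_of_le (congrArg norm ?_) (hC N hN)⟩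
  refine Finset.sum_equiv (Equiv.prodComm ℤ ℤ) (fun k => ?_) fun k _ => by simp
  rw [← knorm_le_iff, ← knorm_le_iff, Equiv.prodComm_apply, knorm_swap]

/-- A product of two real-linear functionals evaluated at `1 / k` has summable differences. -/
lemma summable_norm_sub_of_inv {p q : ℂ →ₗ[ℝ] ℝ} (hp : ∀ w, |p w| ≤ ‖w‖) (hq : ∀ w, |q w| ≤ ‖w‖)
    {u : ℤ × ℤ} (hu : knorm u = 1) :
    Summable fun k : ℤ × ℤ =>
      ‖((p (latticeToComplex (k + u))⁻¹ * q (latticeToComplex (k + u))⁻¹ : ℝ) : ℂ) -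
        ((p (latticeToComplex k)⁻¹ * q (latticeToComplex k)⁻¹ : ℝ) : ℂ)‖ := by
  have hsing : Summable fun k : ℤ × ℤ => if k = 0 then (1 : ℝ) else 0 :=
    (hasSum_ite_eq 0 (1 : ℝ)).summable
  refine ((summable_knorm_inv_pow_three.mul_left 6).add hsing).of_nonneg_of_le
    (fun k => norm_nonneg _) fun k => ?_
  rw [← Complex.ofReal_sub, Complex.norm_real, Real.norm_eq_abs, ← norm_latticeToComplex,
    ← norm_inv]
  have hadd := latticeToComplex_add k u
  have hun : ‖latticeToComplex u‖ = 1 := by rw [norm_latticeToComplex, hu]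
  have hprod : ∀ w, |p w * q w| ≤ ‖w‖ ^ 2 := fun w => by
    rw [abs_mul, sq]
    exact mul_le_mul (hp w) (hq w) (abs_nonneg _) (norm_nonneg _)
  rcases eq_or_ne k 0 with rfl | hk
  · have h0 : latticeToComplex 0 = 0 := latticeToComplex_eq_zero.2 rfl
    have := hprod (latticeToComplex u)⁻¹
    rw [norm_inv, hun] at this
    simpa [h0] using this
  rw [if_neg hk, add_zero]
  have hk' : latticeToComplex k ≠ 0 := fun h => hk (latticeToComplex_eq_zero.1 h)
  rcases eq_or_ne (k + u) 0 with hku | hku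
  · have hk1 : ‖latticeToComplex k‖ = 1 := by
      have h0 := hadd.symm.trans (latticeToComplex_eq_zero.2 hku)
      rw [eq_neg_of_add_eq_zero_left h0, norm_neg, hun]
    have := hprod (latticeToComplex k)⁻¹
    rw [norm_inv, hk1] at this ⊢
    rw [latticeToComplex_eq_zero.2 hku, inv_zero, map_zero, zero_mul, zero_sub, abs_neg]
    linarith
  have hku' : latticeToComplex (k + u) ≠ 0 := fun h => hku (latticeToComplex_eq_zero.1 h)
  set v := (latticeToComplex k)⁻¹ with hv
  set w := (latticeToComplex (k + u))⁻¹ with hw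
  have hwv : ‖w - v‖ = ‖v‖ * ‖w‖ := by
    have : w - v = -(latticeToComplex u) * (v * w) := by
      rw [hv, hw]
      field_simp
      rw [hadd]
      ring
    rw [this, norm_mul, norm_neg, hun, one_mul, norm_mul]
  have hw2 : ‖w‖ ≤ 2 * ‖v‖ := by
    have h1 : 1 ≤ ‖latticeToComplex (k + u)‖ := by
      rw [norm_latticeToComplex]
      exact one_le_knorm hku
    have h2 : ‖latticeToComplex k‖ ≤ 2 * ‖latticeToComplex (k + u)‖ := by
      have := norm_sub_le (latticeToComplex (k + u)) (latticeToComplex u)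
      rw [hadd, add_sub_cancel_right, ← hadd, hun] at this
      linarith
    rw [hv, hw, norm_inv, norm_inv, ← div_eq_mul_inv, inv_eq_one_div,
      div_le_div_iff₀ (by linarith) (norm_pos_iff.2 hk')]
    linarith
  have hsplit : p w * q w - p v * q v = p w * q (w - v) + p (w - v) * q v := by
    rw [map_sub, map_sub]
    ring
  rw [hsplit]
  calc |p w * q (w - v) + p (w - v) * q v|
      ≤ |p w| * |q (w - v)| + |p (w - v)| * |q v| := by
        rw [← abs_mul, ← abs_mul]
        exact abs_add_le _ _
    _ ≤ ‖w‖ * ‖w - v‖ + ‖w - v‖ * ‖v‖ := by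
        gcongr
        exacts [hp _, hq _, hp _, hq _]
    _ = ‖v‖ * (‖w‖ * ‖w‖ + ‖w‖ * ‖v‖) := by rw [hwv]; ring
    _ ≤ ‖v‖ * ((2 * ‖v‖) * (2 * ‖v‖) + (2 * ‖v‖) * ‖v‖) := by gcongr
    _ = 6 * ‖v‖ ^ 3 := by ring

lemma exists_abs_sum_latticeBall_tCos_le {p q : ℂ →ₗ[ℝ] ℝ} (hp : ∀ w, |p w| ≤ ‖w‖)
    (hq : ∀ w, |q w| ≤ ‖w‖) {x : T2} (hx : x ≠ 0) :
    ∃ C, ∀ N, 2 ≤ N → |∑ k ∈ latticeBall N,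
      p (latticeToComplex k)⁻¹ * q (latticeToComplex k)⁻¹ * tCos k x| ≤ C := by
  let a : ℤ × ℤ → ℂ := fun k =>
    ((p (latticeToComplex k)⁻¹ * q (latticeToComplex k)⁻¹ : ℝ) : ℂ)
  let χ : ℤ × ℤ → ℂ := fun k => fourier k.1 x.1 * fourier k.2 x.2
  have ha : ∀ k, ‖a k‖ ≤ (knorm k)⁻¹ ^ 2 := fun k => by
    simp only [a]
    rw [Complex.norm_real, Real.norm_eq_abs, abs_mul, sq, ← norm_latticeToComplex, ← norm_inv]
    exact mul_le_mul (hp _) (hq _) (abs_nonneg _) (norm_nonneg _)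
  have hχ : ∀ k, ‖χ k‖ = 1 := fun k => by
    simp only [χ, norm_mul, fourier_apply, Circle.norm_coe, mul_one]
  have hne : ∀ y : AddCircle (1 : ℝ), y ≠ 0 → (fourier 1 y : ℂ) ≠ 1 := fun y hy h => by
    rw [fourier_one, Circle.coe_eq_one] at h
    exact hy (AddCircle.injective_toCircle one_ne_zero (h.trans AddCircle.toCircle_zero.symm))
  have hbound : ∃ C, ∀ N, 2 ≤ N → ‖∑ k ∈ latticeBall N, a k * χ k‖ ≤ C := by
    by_cases hx1 : x.1 = 0
    · have hx2 : x.2 ≠ 0 := fun h => hx (Prod.ext hx1 h)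
      refine exists_norm_sum_latticeBall_le_of_snd ha
        (summable_norm_sub_of_inv hp hq (by simp [knorm])) hχ (hne _ hx2) fun k => ?_
      simp only [χ, Prod.fst_add, Prod.snd_add, add_zero, fourier_add]
      ring
    · refine exists_norm_sum_latticeBall_le_of_fst ha
        (summable_norm_sub_of_inv hp hq (by simp [knorm])) hχ (hne _ hx1) fun k => ?_
      simp only [χ, Prod.fst_add, Prod.snd_add, add_zero, fourier_add]
      ring
  obtain ⟨C, hC⟩ := hbound
  refine ⟨C, fun N hN => le_trans ?_ (hC N hN)⟩
  refine le_of_eq_of_le (congrArg abs ?_) (Complex.abs_re_le_norm _)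
  rw [Complex.re_sum]
  refine Finset.sum_congr rfl fun k _ => ?_
  simp only [a, χ, Complex.re_ofReal_mul, tCos]

lemma finsum_thetaN_sq (N : ℕ) :
    ∑ᶠ k, thetaN N k ^ 2 = ∑ k ∈ latticeBall N, (knorm k)⁻¹ ^ 2 := by
  rw [finsum_eq_sum_of_support_subset (s := latticeBall N)]
  · refine Finset.sum_congr rfl fun k hk => ?_
    rcases eq_or_ne k 0 with rfl | hk0
    · simp [thetaN, knorm]
    · rw [thetaN, if_pos ⟨hk0, knorm_le_iff.2 hk⟩, one_div]
  · intro k hk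
    by_contra h
    exact hk (by simp [thetaN, knorm_le_iff, Finset.mem_coe.not.1 h])

lemma QN_eq_sum (N : ℕ) (x : T2) :
    QN N x = ∑ k ∈ latticeBall N,
      (tCos k x / knorm k ^ 4) • Matrix.vecMulVec (kperp k) (kperp k) := by
  rw [QN, finsum_eq_sum_of_support_subset (s := latticeBall N)]
  · refine Finset.sum_congr rfl fun k hk => ?_
    rcases eq_or_ne k 0 with rfl | hk0
    · simp [knorm]
    · rw [if_pos ⟨hk0, knorm_le_iff.2 hk⟩]
  · intro k hk
    by_contra h
    exact hk (if_neg fun h' => h (knorm_le_iff.1 h'.2))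

/-- The functionals reading off the components of `-k⊥ / |k|²` from `1 / k`. -/
def perpFunctional : Fin 2 → ℂ →ₗ[ℝ] ℝ := ![Complex.imLm, Complex.reLm]

lemma abs_perpFunctional_le (i : Fin 2) (w : ℂ) : |perpFunctional i w| ≤ ‖w‖ := by
  fin_cases i
  · exact Complex.abs_im_le_norm w
  · exact Complex.abs_re_le_norm w

lemma perpFunctional_inv (i : Fin 2) (k : ℤ × ℤ) :
    perpFunctional i (latticeToComplex k)⁻¹ = -(kperp k i / knorm k ^ 2) := by
  rw [knorm_sq]
  fin_cases i
  · simp [perpFunctional, Complex.inv_im, Complex.normSq_apply, kperp, latticeToComplex, neg_div,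
      ← sq]
  · simp [perpFunctional, Complex.inv_re, Complex.normSq_apply, kperp, latticeToComplex, neg_div,
      ← sq]

lemma QN_apply (N : ℕ) (x : T2) (i j : Fin 2) :
    QN N x i j = ∑ k ∈ latticeBall N, perpFunctional i (latticeToComplex k)⁻¹ *
      perpFunctional j (latticeToComplex k)⁻¹ * tCos k x := by
  rw [QN_eq_sum, Matrix.sum_apply]
  refine Finset.sum_congr rfl fun k _ => ?_
  rw [perpFunctional_inv, perpFunctional_inv, Matrix.smul_apply, Matrix.vecMulVec_apply,
    smul_eq_mul]
  ring

/-- With `θ^N_k = (1/|k|)1_{{|k|≤N}}` and `ε_N = 2√ν/‖θ^N‖_{ℓ²}`, for every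
`x ∈ 𝕋²`, `x ≠ 0`, the matrices `ε_N² Q_N(x)` converge to `0` as `N → ∞`. -/
theorem statement17 (ν : ℝ) (hν : 0 < ν) (x : T2) (hx : x ≠ 0) :
    Tendsto
      (fun N : ℕ =>
        (2 * Real.sqrt ν / Real.sqrt (∑ᶠ k : ℤ × ℤ, thetaN N k ^ 2)) ^ 2 • QN N x)
      atTop (nhds (0 : Matrix (Fin 2) (Fin 2) ℝ)) := by
  refine tendsto_pi_nhds.2 fun i => tendsto_pi_nhds.2 fun j => ?_
  obtain ⟨C, hC⟩ := exists_abs_sum_latticeBall_tCos_le (abs_perpFunctional_le i)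
    (abs_perpFunctional_le j) hx
  have hlim := (tendsto_sum_latticeBall_knorm_inv_sq.const_div_atTop (4 * ν)).mul_const C
  rw [zero_mul] at hlim
  refine squeeze_zero_norm' ?_ hlim
  filter_upwards [eventually_ge_atTop 2] with N hN
  have hT : 0 ≤ ∑ k ∈ latticeBall N, (knorm k)⁻¹ ^ 2 :=
    Finset.sum_nonneg fun k _ => by positivity
  rw [Matrix.smul_apply, smul_eq_mul, finsum_thetaN_sq, QN_apply, div_pow, mul_pow,
    Real.sq_sqrt hν.le, Real.sq_sqrt hT, norm_mul, Real.norm_eq_abs, Real.norm_eq_abs,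
    abs_of_nonneg (by positivity), show (2 : ℝ) ^ 2 = 4 by norm_num]
  exact mul_le_mul_of_nonneg_left (hC N hN) (by positivity)
end
end
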